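/- Let A = FreeAlgebra k S carry a link grading c, r : S → P, let d be a link-graded derivation on A, and let ε : A → k be a k-algebra homomorphism with ε(x) = 0 for every generator x with c(x) ≠ r(x). Set d_ε := φ_ε ∘ d ∘ φ_ε. Then for every generator x ∈ S, the element d_ε(x) lies in the k-linear span of the words composable from c(x) to r(x). (This is the algebra-level form of the paper's proposition that, for an augmentation respecting the link grading, the induced A_∞ products m_k vanish except on composable tuples of morphisms.) -/

import Mathlib

/-!
STATEMENT 5: If `d` is a link-graded derivation on `FreeAlgebra k S` (link grading
`c, r : S → P`) and `ε` is an augmentation respecting the link grading, then the twisted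
differential `d_ε = φ_ε ∘ d ∘ φ_ε` sends each generator `x` into the `k`-linear span of
the words composable from `c x` to `r x`.
-/

/-- `Composable c r i j l` : the list of generators `l` forms a composable word from `i` to `j`. -/
inductive Composable {S P : Type*} (c r : S → P) : P → P → List S → Prop
  | nil (i : P) : Composable c r i i []
  | cons (x : S) {j : P} {l : List S} :
      Composable c r (r x) j l → Composable c r (c x) j (x :: l)

/-- The product in `FreeAlgebra k S` of the word corresponding to a list of generators. -/
def wordProd (k : Type*) [Field k] {S : Type*} (l : List S) : FreeAlgebra k S :=
  (l.map (FreeAlgebra.ι k)).prod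

/-- The `k`-linear span of the composable words from `i` to `j`. -/
def composableSpan (k : Type*) [Field k] {S P : Type*} (c r : S → P) (i j : P) :
    Submodule k (FreeAlgebra k S) :=
  Submodule.span k {a | ∃ l : List S, Composable c r i j l ∧ a = wordProd k l}

/-- Left multiplication by a generator `x` maps the composable span starting at `r x` to the one
starting at `c x`. -/
theorem ι_mul_mem_composableSpan {k S P : Type*} [Field k] {c r : S → P} (x : S) {j : P}
    {a : FreeAlgebra k S} (ha : a ∈ composableSpan k c r (r x) j) :
    FreeAlgebra.ι k x * a ∈ composableSpan k c r (c x) j := by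
  refine Submodule.span_induction (p := fun a _ =>
    FreeAlgebra.ι k x * a ∈ composableSpan k c r (c x) j) ?_ ?_ ?_ ?_ ha
  · rintro _ ⟨l, hl, rfl⟩
    exact Submodule.subset_span ⟨x :: l, .cons x hl, by simp [wordProd]⟩
  · simp
  · intro a b _ _ ha hb
    rw [mul_add]
    exact add_mem ha hb
  · intro t a _ ha
    rw [mul_smul_comm]
    exact Submodule.smul_mem _ t ha

/-- Translating each generator `x` by a scalar `e x` that vanishes unless `c x = r x` preserves the
spans of composable words. -/
theorem map_mem_composableSpan {k S P : Type*} [Field k] {c r : S → P} {e : S → k}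
    (he : ∀ x, c x ≠ r x → e x = 0) {φ : FreeAlgebra k S →ₐ[k] FreeAlgebra k S}
    (hφ : ∀ x, φ (FreeAlgebra.ι k x) =
      FreeAlgebra.ι k x + algebraMap k (FreeAlgebra k S) (e x))
    {i j : P} {a : FreeAlgebra k S} (ha : a ∈ composableSpan k c r i j) :
    φ a ∈ composableSpan k c r i j := by
  suffices h : composableSpan k c r i j ≤ (composableSpan k c r i j).comap φ.toLinearMap from h ha
  refine Submodule.span_le.2 ?_
  rintro _ ⟨l, hl, rfl⟩
  change φ (wordProd k l) ∈ composableSpan k c r i j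
  clear ha
  induction hl with
  | nil i => exact Submodule.subset_span ⟨[], .nil i, by simp [wordProd]⟩
  | @cons x j l _ ih =>
    have hw : φ (wordProd k (x :: l)) =
        FreeAlgebra.ι k x * φ (wordProd k l) + e x • φ (wordProd k l) := by
      simp [wordProd, hφ, add_mul, Algebra.smul_def]
    rw [hw]
    refine add_mem (ι_mul_mem_composableSpan x ih) ?_
    · by_cases hx : c x = r x
      · rw [hx]
        exact Submodule.smul_mem _ _ ih
      · simp [he x hx]

theorem twisted_differential_is_linkGraded
    {k S P : Type*} [Field k] [CharP k 2] (c r : S → P)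
    (d : FreeAlgebra k S →ₗ[k] FreeAlgebra k S)
    (hLeib : ∀ a b : FreeAlgebra k S, d (a * b) = d a * b + a * d b)
    (hlg : ∀ x : S, d (FreeAlgebra.ι k x) ∈ composableSpan k c r (c x) (r x))
    (ε : FreeAlgebra k S →ₐ[k] k)
    (hε : ∀ x : S, c x ≠ r x → ε (FreeAlgebra.ι k x) = 0)
    (φ : FreeAlgebra k S →ₐ[k] FreeAlgebra k S)
    (hφ : ∀ x : S, φ (FreeAlgebra.ι k x) =
      FreeAlgebra.ι k x + algebraMap k (FreeAlgebra k S) (ε (FreeAlgebra.ι k x))) :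
    ∀ x : S, φ (d (φ (FreeAlgebra.ι k x))) ∈ composableSpan k c r (c x) (r x) := by
  intro x
  have hd_one : d 1 = 0 := by simpa using hLeib 1 1
  have hd : d (φ (FreeAlgebra.ι k x)) = d (FreeAlgebra.ι k x) := by
    rw [hφ, map_add, Algebra.algebraMap_eq_smul_one, map_smul, hd_one, smul_zero, add_zero]
  rw [hd]
  exact map_mem_composableSpan hε hφ (hlg x)
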